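/- arXiv:1905.08664 — 2 statements merged into one kernel-verified Lean document; each statement's English description precedes it below -/
import Mathlib

section
/- Let d ≥ 1, let A ∈ ℤ^{d×d} be lower triangular (A_{ij} = 0 whenever i < j) with non-negative diagonal entries (A_{ii} ≥ 0 for all i), and let p₁,…,p_d : ℤ^d → ℕ → ℚ be poly-exponential expressions. Then there exist poly-exponential expressions q₁,…,q_d : ℤ^d → ℕ → ℚ such that, writing q(x,n) = (q₁(x,n),…,q_d(x,n)) ∈ ℚ^d and p(x,n) analogously: q(x, 0) = x (cast from ℤ^d into ℚ^d), and q(x, n) = A·q(x, n−1) + p(x, n−1) for all x ∈ ℤ^d and all n > 0 (matrix–vector product over ℚ). -/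
/-- A function `p : ℤ^d → ℕ → ℚ` is a poly-exponential expression if it is a
finite sum of terms `1_{S_j}(n) · α_j(x) · n^{a_j} · b_j^n` where each `S_j ⊆ ℕ`
is empty, a singleton, or has finite complement, each `α_j` is affine, and
`b_j ≥ 1`. -/
def IsPolyExp {d : ℕ} (p : (Fin d → ℤ) → ℕ → ℚ) : Prop :=
  ∃ (ℓ : ℕ) (S : Fin ℓ → Set ℕ) (v : Fin ℓ → Fin d → ℚ) (w : Fin ℓ → ℚ)
    (a : Fin ℓ → ℕ) (b : Fin ℓ → ℕ),
    (∀ j, S j = ∅ ∨ (∃ c : ℕ, S j = {c}) ∨ (S j)ᶜ.Finite) ∧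
    (∀ j, 1 ≤ b j) ∧
    ∀ (x : Fin d → ℤ) (n : ℕ),
      p x n = ∑ j, (S j).indicator (fun _ => (1 : ℚ)) n *
        ((∑ i, v j i * (x i : ℚ)) + w j) * (n : ℚ) ^ a j * (b j : ℚ) ^ n

/-- The affine function `x ↦ vᵀx + w`. -/
def affineEval {d : ℕ} (v : Fin d → ℚ) (w : ℚ) (x : Fin d → ℤ) : ℚ :=
  (∑ i, v i * (x i : ℚ)) + w

/-- The space of sequences spanned by `n ↦ n ^ a * b ^ n` with `1 ≤ b` and by the point masses. -/
def polyExpSeq : Submodule ℚ (ℕ → ℚ) :=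
  Submodule.span ℚ ({h | ∃ a b : ℕ, 1 ≤ b ∧ h = fun n : ℕ => (n : ℚ) ^ a * (b : ℚ) ^ n} ∪
    Set.range fun k : ℕ => Pi.single k (1 : ℚ))

theorem pow_mul_pow_mem_polyExpSeq (a : ℕ) {b : ℕ} (hb : 1 ≤ b) :
    (fun n : ℕ => (n : ℚ) ^ a * (b : ℚ) ^ n) ∈ polyExpSeq :=
  Submodule.subset_span (Or.inl ⟨a, b, hb, rfl⟩)

theorem single_mem_polyExpSeq (k : ℕ) : (Pi.single k 1 : ℕ → ℚ) ∈ polyExpSeq :=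
  Submodule.subset_span (Or.inr ⟨k, rfl⟩)

theorem indicator_mem_polyExpSeq_of_finite {S : Set ℕ} (hS : S.Finite) (h : ℕ → ℚ) :
    S.indicator h ∈ polyExpSeq := by
  have key : S.indicator h = ∑ k ∈ hS.toFinset, h k • (Pi.single k 1 : ℕ → ℚ) := by
    classical
    ext n
    simp [Set.indicator_apply, Pi.single_apply]
  rw [key]
  exact Submodule.sum_mem _ fun k _ => Submodule.smul_mem _ _ (single_mem_polyExpSeq k)

theorem indicator_mem_polyExpSeq_of_finite_compl {S : Set ℕ} (hS : Sᶜ.Finite) {h : ℕ → ℚ}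
    (hh : h ∈ polyExpSeq) : S.indicator h ∈ polyExpSeq := by
  have key : S.indicator h = h - Sᶜ.indicator h := by
    rw [eq_sub_iff_add_eq, Set.indicator_self_add_compl]
  rw [key]
  exact Submodule.sub_mem _ hh (indicator_mem_polyExpSeq_of_finite hS h)

/-- The first-order difference operator `g ↦ (n ↦ g (n + 1) - c * g n)`. -/
def shiftSub (c : ℚ) : (ℕ → ℚ) →ₗ[ℚ] (ℕ → ℚ) where
  toFun g n := g (n + 1) - c * g n
  map_add' f g := by ext n; simp; ring
  map_smul' r g := by ext n; simp; ring

theorem shiftSub_apply (c : ℚ) (g : ℕ → ℚ) (n : ℕ) :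
    shiftSub c g n = g (n + 1) - c * g n := rfl

theorem exists_geometric_mem_polyExpSeq (c : ℕ) :
    ∃ e ∈ polyExpSeq, e 0 = 1 ∧ ∀ n, e (n + 1) = (c : ℚ) * e n := by
  rcases Nat.eq_zero_or_pos c with rfl | hc
  · exact ⟨_, single_mem_polyExpSeq 0, by simp, by simp⟩
  · exact ⟨_, pow_mul_pow_mem_polyExpSeq 0 hc, by simp, fun n => by simp [pow_succ']⟩

theorem single_mem_map_shiftSub (c k : ℕ) :
    (Pi.single k 1 : ℕ → ℚ) ∈ polyExpSeq.map (shiftSub c) := by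
  rcases Nat.eq_zero_or_pos c with rfl | hc
  · refine ⟨_, single_mem_polyExpSeq (k + 1), ?_⟩
    ext n
    simp [shiftSub_apply, Pi.single_apply]
  · have hfin : ((Set.Ioi k)ᶜ : Set ℕ).Finite := by
      rw [Set.compl_Ioi]
      exact Set.finite_Iic k
    refine ⟨((c : ℚ) ^ (k + 1))⁻¹ • (Set.Ioi k).indicator fun n : ℕ => (n : ℚ) ^ 0 * (c : ℚ) ^ n,
      Submodule.smul_mem _ _ (indicator_mem_polyExpSeq_of_finite_compl hfin
        (pow_mul_pow_mem_polyExpSeq 0 hc)), ?_⟩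
    have hc' : (c : ℚ) ≠ 0 := by positivity
    ext n
    rcases lt_trichotomy n k with h | rfl | h
    · have h1 : ¬ k < n := by omega
      have h2 : ¬ k < n + 1 := by omega
      simp [shiftSub_apply, h1, h2, h.ne]
    · simp [shiftSub_apply, hc']
    · have h2 : k < n + 1 := by omega
      simp only [shiftSub_apply, Set.indicator_apply, Pi.smul_apply, Set.mem_Ioi, h, h2, if_true,
        smul_eq_mul, Pi.single_eq_of_ne h.ne']
      ring

theorem pow_mul_pow_mem_map_shiftSub (c : ℕ) {b : ℕ} (hb : 1 ≤ b) (a : ℕ) :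
    (fun n : ℕ => (n : ℚ) ^ a * (b : ℚ) ^ n) ∈ polyExpSeq.map (shiftSub c) := by
  induction a using Nat.strong_induction_on with
  | _ a ih =>
    have hb0 : (b : ℚ) ≠ 0 := by positivity
    -- a correction by lower powers of `n` suffices
    have reduce : ∀ (a' : ℕ) (r : ℚ) (u : ℕ → ℚ), (∀ n : ℕ,
        r * (((n + 1 : ℕ) : ℚ) ^ a' * (b : ℚ) ^ (n + 1) - c * ((n : ℚ) ^ a' * (b : ℚ) ^ n)) =
          (n : ℚ) ^ a * (b : ℚ) ^ n
            + ∑ m ∈ Finset.range a, u m * ((n : ℚ) ^ m * (b : ℚ) ^ n)) →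
        (fun n : ℕ => (n : ℚ) ^ a * (b : ℚ) ^ n) ∈ polyExpSeq.map (shiftSub c) := by
      intro a' r u h
      have key : (fun n : ℕ => (n : ℚ) ^ a * (b : ℚ) ^ n) =
          r • shiftSub c (fun n : ℕ => (n : ℚ) ^ a' * (b : ℚ) ^ n) -
            ∑ m ∈ Finset.range a, u m • fun n : ℕ => (n : ℚ) ^ m * (b : ℚ) ^ n := by
        ext n
        simp [shiftSub_apply, Finset.sum_apply] at h ⊢
        rw [h n]
        ring
      rw [key]
      refine Submodule.sub_mem _ (Submodule.smul_mem _ _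
        (Submodule.mem_map_of_mem (pow_mul_pow_mem_polyExpSeq a' hb))) ?_
      exact Submodule.sum_mem _ fun m hm =>
        Submodule.smul_mem _ _ (ih m (Finset.mem_range.mp hm))
    by_cases hcb : c = b
    · subst hcb
      have ha : (a : ℚ) + 1 ≠ 0 := by positivity
      refine reduce (a + 1) ((c : ℚ) * (a + 1))⁻¹
        (fun m => ((a : ℚ) + 1)⁻¹ * ((a + 1).choose m : ℚ)) fun n => ?_
      have hsum : ∑ m ∈ Finset.range a,
            (((a : ℚ) + 1)⁻¹ * ((a + 1).choose m : ℚ)) * ((n : ℚ) ^ m * (c : ℚ) ^ n) =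
          ((a : ℚ) + 1)⁻¹ * (c : ℚ) ^ n *
            ∑ m ∈ Finset.range a, (n : ℚ) ^ m * ((a + 1).choose m : ℚ) := by
        rw [Finset.mul_sum]
        exact Finset.sum_congr rfl fun m _ => by ring
      rw [hsum]
      push_cast
      rw [add_pow, Finset.sum_range_succ, Finset.sum_range_succ]
      simp only [one_pow, mul_one, Nat.choose_self, Nat.choose_succ_self_right, Nat.cast_one]
      push_cast
      field_simp
      ring
    · have hbc : (b : ℚ) - c ≠ 0 := by
        rw [sub_ne_zero]
        exact_mod_cast Ne.symm hcb
      refine reduce a ((b : ℚ) - c)⁻¹ (fun m => ((b : ℚ) - c)⁻¹ * b * (a.choose m : ℚ))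
        fun n => ?_
      have hsum : ∑ m ∈ Finset.range a,
            (((b : ℚ) - c)⁻¹ * b * (a.choose m : ℚ)) * ((n : ℚ) ^ m * (b : ℚ) ^ n) =
          ((b : ℚ) - c)⁻¹ * b * (b : ℚ) ^ n *
            ∑ m ∈ Finset.range a, (n : ℚ) ^ m * (a.choose m : ℚ) := by
        rw [Finset.mul_sum]
        exact Finset.sum_congr rfl fun m _ => by ring
      rw [hsum]
      push_cast
      rw [add_pow, Finset.sum_range_succ]
      simp only [one_pow, mul_one, Nat.choose_self, Nat.cast_one]
      field_simp
      ring

theorem polyExpSeq_le_map_shiftSub (c : ℕ) : polyExpSeq ≤ polyExpSeq.map (shiftSub c) := by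
  refine Submodule.span_le.mpr ?_
  rintro h (⟨a, b, hb, rfl⟩ | ⟨k, rfl⟩)
  · exact pow_mul_pow_mem_map_shiftSub c hb a
  · exact single_mem_map_shiftSub c k

theorem exists_recurrence_mem_polyExpSeq (c : ℕ) {h : ℕ → ℚ} (hh : h ∈ polyExpSeq) :
    ∃ g ∈ polyExpSeq, g 0 = 0 ∧ ∀ n, g (n + 1) = (c : ℚ) * g n + h n := by
  obtain ⟨g, hg, rfl⟩ := polyExpSeq_le_map_shiftSub c hh
  obtain ⟨e, he, he0, hes⟩ := exists_geometric_mem_polyExpSeq c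
  refine ⟨g - g 0 • e, Submodule.sub_mem _ hg (Submodule.smul_mem _ _ he), by simp [he0],
    fun n => ?_⟩
  simp only [Pi.sub_apply, Pi.smul_apply, smul_eq_mul, hes, shiftSub_apply]
  ring

theorem isPolyExp_of_fintype {d : ℕ} {ι : Type*} [Fintype ι] {p : (Fin d → ℤ) → ℕ → ℚ}
    (S : ι → Set ℕ) (v : ι → Fin d → ℚ) (w : ι → ℚ) (a b : ι → ℕ)
    (hS : ∀ j, S j = ∅ ∨ (∃ c : ℕ, S j = {c}) ∨ (S j)ᶜ.Finite) (hb : ∀ j, 1 ≤ b j)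
    (hp : ∀ x n, p x n = ∑ j, (S j).indicator (fun _ => (1 : ℚ)) n *
      ((∑ i, v j i * (x i : ℚ)) + w j) * (n : ℚ) ^ a j * (b j : ℚ) ^ n) : IsPolyExp p := by
  let e := (Fintype.equivFin ι).symm
  refine ⟨Fintype.card ι, S ∘ e, v ∘ e, w ∘ e, a ∘ e, b ∘ e, fun j => hS _, fun j => hb _,
    fun x n => ?_⟩
  rw [hp, ← e.sum_comp]
  rfl

theorem IsPolyExp.zero {d : ℕ} : IsPolyExp (fun (_ : Fin d → ℤ) _ => 0) :=
  isPolyExp_of_fintype (ι := Empty) nofun nofun nofun nofun nofun nofun nofun (by simp)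

theorem IsPolyExp.add {d : ℕ} {p q : (Fin d → ℤ) → ℕ → ℚ} (hp : IsPolyExp p)
    (hq : IsPolyExp q) : IsPolyExp (fun x n => p x n + q x n) := by
  obtain ⟨ℓ, S, v, w, a, b, hS, hb, h⟩ := hp
  obtain ⟨ℓ', S', v', w', a', b', hS', hb', h'⟩ := hq
  refine isPolyExp_of_fintype (Sum.elim S S') (Sum.elim v v') (Sum.elim w w') (Sum.elim a a')
    (Sum.elim b b') ?_ ?_ fun x n => ?_
  · rintro (j | j)
    exacts [hS j, hS' j]
  · rintro (j | j)
    exacts [hb j, hb' j]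
  · simp only [h, h', Fintype.sum_sum_type, Sum.elim_inl, Sum.elim_inr]

theorem IsPolyExp.const_mul {d : ℕ} {p : (Fin d → ℤ) → ℕ → ℚ} (r : ℚ) (hp : IsPolyExp p) :
    IsPolyExp (fun x n => r * p x n) := by
  obtain ⟨ℓ, S, v, w, a, b, hS, hb, h⟩ := hp
  refine ⟨ℓ, S, fun j i => r * v j i, fun j => r * w j, a, b, hS, hb, fun x n => ?_⟩
  beta_reduce
  rw [h, Finset.mul_sum]
  refine Finset.sum_congr rfl fun j _ => ?_
  simp only [mul_assoc r, ← Finset.mul_sum]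
  ring

theorem IsPolyExp.sum {d : ℕ} {ι : Type*} (s : Finset ι) {p : ι → (Fin d → ℤ) → ℕ → ℚ}
    (hp : ∀ j ∈ s, IsPolyExp (p j)) : IsPolyExp (fun x n => ∑ j ∈ s, p j x n) := by
  classical
  induction s using Finset.induction_on with
  | empty => simpa using IsPolyExp.zero
  | insert j s hj ih =>
    simp only [Finset.sum_insert hj]
    exact (hp j (Finset.mem_insert_self j s)).add
      (ih fun k hk => hp k (Finset.mem_insert_of_mem hk))

theorem isPolyExp_affineEval_mul {d : ℕ} (v : Fin d → ℚ) (w : ℚ) {h : ℕ → ℚ}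
    (hh : h ∈ polyExpSeq) : IsPolyExp (fun x n => affineEval v w x * h n) := by
  induction hh using Submodule.span_induction with
  | mem h hh =>
    rcases hh with ⟨a, b, hb, rfl⟩ | ⟨k, rfl⟩
    · exact ⟨1, fun _ => Set.univ, fun _ => v, fun _ => w, fun _ => a, fun _ => b,
        fun _ => by simp, fun _ => hb, fun x n => by simp [affineEval, mul_assoc]⟩
    · exact ⟨1, fun _ => {k}, fun _ => v, fun _ => w, fun _ => 0, fun _ => 1,
        fun _ => by simp, fun _ => le_rfl, fun x n => by
          simp [affineEval, Pi.single_apply, Set.indicator_apply]⟩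
  | zero => simpa using IsPolyExp.zero
  | add f g _ _ hf hg => simpa [mul_add] using hf.add hg
  | smul r f _ hf => simpa [mul_left_comm] using hf.const_mul r

theorem IsPolyExp.exists_eq_sum_affineEval_mul {d : ℕ} {p : (Fin d → ℤ) → ℕ → ℚ}
    (hp : IsPolyExp p) : ∃ (ℓ : ℕ) (v : Fin ℓ → Fin d → ℚ) (w : Fin ℓ → ℚ) (h : Fin ℓ → ℕ → ℚ),
      (∀ j, h j ∈ polyExpSeq) ∧ ∀ x n, p x n = ∑ j, affineEval (v j) (w j) x * h j n := by
  obtain ⟨ℓ, S, v, w, a, b, hS, hb, h⟩ := hp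
  refine ⟨ℓ, v, w, fun j => (S j).indicator fun n : ℕ => (n : ℚ) ^ a j * (b j : ℚ) ^ n,
    fun j => ?_, fun x n => ?_⟩
  · rcases hS j with hj | ⟨c, hj⟩ | hj
    · exact indicator_mem_polyExpSeq_of_finite (hj ▸ Set.finite_empty) _
    · exact indicator_mem_polyExpSeq_of_finite (hj ▸ Set.finite_singleton c) _
    · exact indicator_mem_polyExpSeq_of_finite_compl hj (pow_mul_pow_mem_polyExpSeq _ (hb j))
  · rw [h]
    refine Finset.sum_congr rfl fun j _ => ?_
    by_cases hn : n ∈ S j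
    · simp [hn, affineEval, mul_assoc]
    · simp [hn]

theorem isPolyExp_of_recurrence {d : ℕ} (c : ℕ) (v : Fin d → ℚ) (w : ℚ)
    {f q : (Fin d → ℤ) → ℕ → ℚ} (hf : IsPolyExp f) (h0 : ∀ x, q x 0 = affineEval v w x)
    (hs : ∀ x n, q x (n + 1) = (c : ℚ) * q x n + f x n) : IsPolyExp q := by
  obtain ⟨ℓ, v', w', h, hh, hfh⟩ := hf.exists_eq_sum_affineEval_mul
  choose g hg hg0 hgs using fun j => exists_recurrence_mem_polyExpSeq c (hh j)
  obtain ⟨e, he, he0, hes⟩ := exists_geometric_mem_polyExpSeq c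
  have key : q = fun x n =>
      affineEval v w x * e n + ∑ j, affineEval (v' j) (w' j) x * g j n := by
    ext x n
    induction n with
    | zero => simp [h0, he0, hg0]
    | succ n ih =>
      rw [hs, ih, hfh, hes, mul_add, Finset.mul_sum, add_assoc, ← Finset.sum_add_distrib,
        mul_left_comm]
      congr 1
      refine Finset.sum_congr rfl fun j _ => ?_
      rw [hgs]
      ring
  rw [key]
  exact (isPolyExp_affineEval_mul v w he).add
    (IsPolyExp.sum _ fun j _ => isPolyExp_affineEval_mul _ _ (hg j))

/-- The orbit of `x` under the update `y ↦ A y + p(x, n)`. -/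
def affineOrbit {d : ℕ} (A : Matrix (Fin d) (Fin d) ℤ) (p : Fin d → (Fin d → ℤ) → ℕ → ℚ)
    (x : Fin d → ℤ) : ℕ → Fin d → ℚ
  | 0, i => x i
  | n + 1, i => (∑ j, (A i j : ℚ) * affineOrbit A p x n j) + p i x n

theorem isPolyExp_affineOrbit {d : ℕ} (A : Matrix (Fin d) (Fin d) ℤ)
    (hTri : ∀ i j : Fin d, i < j → A i j = 0) (hDiag : ∀ i : Fin d, 0 ≤ A i i)
    (p : Fin d → (Fin d → ℤ) → ℕ → ℚ) (hp : ∀ i, IsPolyExp (p i)) (i : Fin d) :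
    IsPolyExp (fun x n => affineOrbit A p x n i) := by
  induction i using WellFoundedLT.induction with
  | _ i ih =>
    refine isPolyExp_of_recurrence (A i i).toNat (Pi.single i 1) 0
      (f := fun x n => (∑ j ∈ Finset.Iio i, (A i j : ℚ) * affineOrbit A p x n j) + p i x n)
      ((IsPolyExp.sum _ fun j hj => (ih j (Finset.mem_Iio.mp hj)).const_mul _).add (hp i))
      (fun x => by simp [affineOrbit, affineEval, Pi.single_apply]) fun x n => ?_
    have hcast : ((A i i).toNat : ℚ) = (A i i : ℚ) := by
      exact_mod_cast Int.toNat_of_nonneg (hDiag i)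
    have hsum : ∑ j, (A i j : ℚ) * affineOrbit A p x n j =
        ∑ j ∈ Finset.Iic i, (A i j : ℚ) * affineOrbit A p x n j := by
      refine (Finset.sum_subset (Finset.subset_univ _) fun j _ hj => ?_).symm
      rw [hTri i j (by simpa using hj), Int.cast_zero, zero_mul]
    rw [affineOrbit, hsum, hcast, ← Finset.Iio_insert, Finset.sum_insert (by simp), add_assoc]

/-- closed forms for vectors of variables: for a lower triangular
integer matrix `A` with non-negative diagonal and poly-exponential `p₁,…,p_d`,
there are poly-exponential `q₁,…,q_d` with `q(x,0) = x` and
`q(x,n) = A·q(x,n−1) + p(x,n−1)` for `n > 0`. -/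
theorem closed_form_vector (d : ℕ) (hd : 1 ≤ d)
    (A : Matrix (Fin d) (Fin d) ℤ)
    (hTri : ∀ i j : Fin d, i < j → A i j = 0)
    (hDiag : ∀ i : Fin d, 0 ≤ A i i)
    (p : Fin d → (Fin d → ℤ) → ℕ → ℚ) (hp : ∀ i, IsPolyExp (p i)) :
    ∃ q : Fin d → (Fin d → ℤ) → ℕ → ℚ,
      (∀ i, IsPolyExp (q i)) ∧
      (∀ (x : Fin d → ℤ) (i : Fin d), q i x 0 = (x i : ℚ)) ∧
      (∀ (x : Fin d → ℤ) (n : ℕ), 0 < n → ∀ i : Fin d,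
        q i x n = (∑ j, (A i j : ℚ) * q j x (n - 1)) + p i x (n - 1)) := by
  refine ⟨fun i x n => affineOrbit A p x n i, isPolyExp_affineOrbit A hTri hDiag p hp,
    fun x i => rfl, fun x n hn i => ?_⟩
  obtain ⟨m, rfl⟩ := Nat.exists_eq_add_of_lt hn
  simp [affineOrbit]
end

section
/- Let p be a normalized poly-exponential sequence, p(n) = ∑_{j=1}^ℓ c_j·n^{a_j}·b_jⁿ with ℓ ∈ ℕ (possibly ℓ = 0, in which case p = 0), c_j ∈ ℚ \ {0}, a_j ∈ ℕ, b_j ∈ ℕ with b_j ≥ 1, and pairwise distinct pairs (b_j, a_j). Then there exists n₀ ∈ ℕ such that p(n) > 0 for all n > n₀ if and only if, viewed as a real sequence, p tends to +∞ as n → ∞ or p converges to a positive real limit as n → ∞. -/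
open Filter

open Asymptotics

/-- Of two sequences `n ^ a * b ^ n`, the one whose pair `(b, a)` is lexicographically smaller is
negligible. -/
theorem isLittleO_pow_mul_pow_of_lex_lt {a a' b b' : ℕ} (h : b < b' ∨ b = b' ∧ a < a') :
    (fun n : ℕ => (n : ℝ) ^ a * (b : ℝ) ^ n) =o[atTop]
      fun n : ℕ => (n : ℝ) ^ a' * (b' : ℝ) ^ n := by
  rcases h with h | ⟨rfl, h⟩
  · have hlt : ‖(b : ℝ)‖ < (b' : ℝ) := by simpa using h
    refine (isLittleO_pow_const_mul_const_pow_const_pow_of_norm_lt a hlt).trans_isBigO ?_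
    refine IsBigO.of_bound 1 ?_
    filter_upwards [eventually_ge_atTop 1] with n hn
    have hn' : (1 : ℝ) ≤ n := by exact_mod_cast hn
    rw [norm_mul, one_mul]
    refine le_mul_of_one_le_left (norm_nonneg _) ?_
    rw [norm_pow, Real.norm_natCast]
    exact one_le_pow₀ hn'
  · exact ((isLittleO_pow_pow_atTop_of_lt (𝕜 := ℝ) h).comp_tendsto
      tendsto_natCast_atTop_atTop).mul_isBigO (isBigO_refl _ _)

/-- A sequence tending to `+∞` or to a positive limit is eventually positive. -/
theorem eventually_pos_of_tendsto_atTop_or_nhds_pos {f : ℕ → ℝ}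
    (h : Tendsto f atTop atTop ∨ ∃ L : ℝ, 0 < L ∧ Tendsto f atTop (nhds L)) :
    ∀ᶠ n in atTop, 0 < f n := by
  rcases h with h | ⟨L, hL, h⟩
  · exact h.eventually_gt_atTop 0
  · exact h.eventually_const_lt hL

/-- A sequence equivalent to `c * n ^ a * b ^ n` with `c > 0` and `b ≥ 1` tends to `+∞` or to a
positive limit. -/
theorem tendsto_atTop_or_nhds_pos_of_isEquivalent {f : ℕ → ℝ} {c : ℝ} {a b : ℕ}
    (hc : 0 < c) (hb : 1 ≤ b)
    (h : f ~[atTop] fun n : ℕ => c * ((n : ℝ) ^ a * (b : ℝ) ^ n)) :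
    Tendsto f atTop atTop ∨ ∃ L : ℝ, 0 < L ∧ Tendsto f atTop (nhds L) := by
  by_cases htriv : a = 0 ∧ b = 1
  · obtain ⟨rfl, rfl⟩ := htriv
    exact .inr ⟨c, hc, h.symm.tendsto_nhds (by simp)⟩
  · left
    refine h.symm.tendsto_atTop (Tendsto.const_mul_atTop hc ?_)
    have hlex : 1 < b ∨ 1 = b ∧ 0 < a := by omega
    have ho := isLittleO_pow_mul_pow_of_lex_lt hlex
    simp only [pow_zero, Nat.cast_one, one_pow, mul_one] at ho
    refine ((isLittleO_one_left_iff ℝ).1 ho).congr fun n => ?_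
    exact Real.norm_of_nonneg (by positivity)

/-- A finite combination of sequences `n ^ a j * b j ^ n` is equivalent to its term with the
lexicographically largest pair `(b j, a j)`. -/
theorem exists_isEquivalent_sum_pow_mul_pow {ι : Type*} [Fintype ι] [Nonempty ι]
    {c : ι → ℝ} (hc : ∀ j, c j ≠ 0) {a b : ι → ℕ}
    (hdist : ∀ i j : ι, i ≠ j → (b i, a i) ≠ (b j, a j)) :
    ∃ k, (fun n : ℕ => ∑ j, c j * ((n : ℝ) ^ a j * (b j : ℝ) ^ n)) ~[atTop]
      fun n : ℕ => c k * ((n : ℝ) ^ a k * (b k : ℝ) ^ n) := by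
  classical
  obtain ⟨k, hk⟩ := Finite.exists_max fun j => toLex (b j, a j)
  refine ⟨k, ?_⟩
  have hsum : (fun n : ℕ => ∑ j ∈ Finset.univ.erase k, c j * ((n : ℝ) ^ a j * (b j : ℝ) ^ n))
      =o[atTop] fun n : ℕ => c k * ((n : ℝ) ^ a k * (b k : ℝ) ^ n) := by
    refine IsLittleO.fun_sum fun j hj => ?_
    have hlt : toLex (b j, a j) < toLex (b k, a k) :=
      lt_of_le_of_ne (hk j) fun h => hdist j k (Finset.ne_of_mem_erase hj) (toLex.injective h)
    have ho := isLittleO_pow_mul_pow_of_lex_lt (Prod.Lex.toLex_lt_toLex.1 hlt)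
    exact (ho.const_mul_left (c j)).trans_isBigO (isBigO_self_const_mul (hc k) _ _)
  refine hsum.congr_left fun n => ?_
  rw [Pi.sub_apply, ← Finset.add_sum_erase Finset.univ _ (Finset.mem_univ k), add_sub_cancel_left]

/-- a normalized poly-exponential sequence is eventually positive
iff (as a real sequence) it tends to `+∞` or converges to a positive limit. -/
theorem npe_eventually_positive_iff_limit (ℓ : ℕ)
    (c : Fin ℓ → ℚ) (hc : ∀ j, c j ≠ 0)
    (a : Fin ℓ → ℕ) (b : Fin ℓ → ℕ) (hb : ∀ j, 1 ≤ b j)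
    (hdist : ∀ i j : Fin ℓ, i ≠ j → (b i, a i) ≠ (b j, a j))
    (p : ℕ → ℚ)
    (hp : ∀ n : ℕ, p n = ∑ j, c j * (n : ℚ) ^ a j * (b j : ℚ) ^ n) :
    (∃ n₀ : ℕ, ∀ n : ℕ, n₀ < n → 0 < p n) ↔
    (Tendsto (fun n : ℕ => ((p n : ℝ))) atTop atTop ∨
     ∃ L : ℝ, 0 < L ∧ Tendsto (fun n : ℕ => ((p n : ℝ))) atTop (nhds L)) := by
  have hev : (∃ n₀ : ℕ, ∀ n : ℕ, n₀ < n → 0 < p n) ↔ ∀ᶠ n in atTop, 0 < (p n : ℝ) := by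
    simp only [Rat.cast_pos]
    exact (atTop_basis_Ioi.eventually_iff.trans (by simp)).symm
  rw [hev]
  refine ⟨fun hpos => ?_, eventually_pos_of_tendsto_atTop_or_nhds_pos⟩
  have hsum : (fun n => (p n : ℝ)) =
      fun n : ℕ => ∑ j, (c j : ℝ) * ((n : ℝ) ^ a j * (b j : ℝ) ^ n) := by
    ext n
    simp [hp, mul_assoc]
  have hne : Nonempty (Fin ℓ) := by
    by_contra hempty
    rw [not_nonempty_iff] at hempty
    obtain ⟨n, hn⟩ := hpos.exists
    simp [hp] at hn
  obtain ⟨k, hk⟩ := exists_isEquivalent_sum_pow_mul_pow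
    (c := fun j => (c j : ℝ)) (fun j => by exact_mod_cast hc j) hdist
  rw [← hsum] at hk
  refine tendsto_atTop_or_nhds_pos_of_isEquivalent ?_ (hb k) hk
  by_contra hneg
  have hck : (0 : ℝ) < -(c k : ℝ) := by
    have hck0 : (c k : ℝ) ≠ 0 := by exact_mod_cast hc k
    exact neg_pos.2 (lt_of_le_of_ne (not_lt.1 hneg) hck0)
  have hk' : (fun n => -(p n : ℝ)) ~[atTop]
      fun n : ℕ => -(c k : ℝ) * ((n : ℝ) ^ a k * (b k : ℝ) ^ n) := by
    simpa only [neg_mul] using hk.neg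
  have hpos' := eventually_pos_of_tendsto_atTop_or_nhds_pos
    (tendsto_atTop_or_nhds_pos_of_isEquivalent hck (hb k) hk')
  obtain ⟨n, h₁, h₂⟩ := (hpos.and hpos').exists
  linarith
end
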